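/- For ν > 1, a ∈ F_{2^{m_1}}^* and b ∈ F_4^*: if the Boolean function f_{a,b} on F_{2^n} is bent, then K_{m_1}(a) = 4. -/

import Mathlib

open Finset

attribute [local instance] Classical.propDecidable

noncomputable section

/-- The absolute trace `Tr^k` of `GF(2^k)`, as a function on an ambient field of
characteristic two containing `GF(2^k)`. -/
def absTr {F : Type*} [Field F] (k : ℕ) (x : F) : F :=
  ∑ i ∈ Finset.range k, x ^ 2 ^ i

/-- The relative field trace `Tr^k_j` from `GF(2^k)` to `GF(2^j)`. -/
def relTr {F : Type*} [Field F] (k j : ℕ) (x : F) : F :=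
  ∑ i ∈ Finset.range (k / j), x ^ 2 ^ (j * i)

/-- `(-1)^b` for `b ∈ F_2`, viewed inside an ambient field of characteristic two. -/
def sgn {F : Type*} [Field F] (b : F) : ℤ := if b = 0 then 1 else -1

/-- The subfield `GF(2^k)` of the ambient field, as a finset. -/
def gf (F : Type*) [Field F] [Fintype F] (k : ℕ) : Finset F :=
  Finset.univ.filter fun x => x ^ 2 ^ k = x

/-- The trace of `F_4` down to `F_2`, `tr_2(y) = y + y²`. -/
def tr2 {F : Type*} [Field F] (y : F) : F := y + y ^ 2

/-- The cubic multiplicative character `χ_k(x) = x^((2^k-1)/3)` of `GF(2^k)`. -/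
def chi {F : Type*} [Field F] (k : ℕ) (x : F) : F := x ^ ((2 ^ k - 1) / 3)

/-- The Walsh transform at `ω` of a Boolean function on `GF(2^n)`
(with values in `F_2` inside the ambient field). -/
def walsh {F : Type*} [Field F] [Fintype F] (n : ℕ) (f : F → F) (ω : F) : ℤ :=
  ∑ x : F, sgn (f x + absTr n (ω * x))

/-- The binary Kloosterman sum `K_k(a)` (with the convention `0⁻¹ = 0`). -/
def kloo {F : Type*} [Field F] [Fintype F] (k : ℕ) (a : F) : ℤ :=
  ∑ x ∈ gf F k, sgn (absTr k (a * x + x⁻¹))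

/-- The binary cubic sum `C_k(a,b)`. -/
def cub {F : Type*} [Field F] [Fintype F] (k : ℕ) (a b : F) : ℤ :=
  ∑ x ∈ gf F k, sgn (absTr k (a * x ^ 3 + b * x))

/-- `f_a(x) = Tr^n(a · x^(2^{m₁}-1))`. -/
def fA {F : Type*} [Field F] (n m1 : ℕ) (a x : F) : F :=
  absTr n (a * x ^ (2 ^ m1 - 1))

/-- `g_b(x) = tr_2(b · χ_n(x))`. -/
def gB {F : Type*} [Field F] (n : ℕ) (b x : F) : F := tr2 (b * chi n x)

/-- The binomial Boolean function `f_{a,b} = f_a + g_b`. -/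
def fAB {F : Type*} [Field F] (n m1 : ℕ) (a b x : F) : F :=
  fA n m1 a x + gB n b x

/-- `U`, the image of `U_1 × ⋯ × U_ν` in `GF(2^n)^*` under multiplication, where
`U_i` is the subgroup of `(2^{m_i}+1)`-th roots of unity and `m_i = 2^{ν-i}·m`. -/
def bigU (F : Type*) [Field F] [Fintype F] (ν m : ℕ) : Finset F :=
  Finset.univ.filter fun u => ∃ c : Fin ν → F,
    (∀ i : Fin ν, c i ^ (2 ^ (2 ^ (ν - 1 - (i : ℕ)) * m) + 1) = 1) ∧ u = ∏ i, c i

theorem sum_comp_eq_mul_sum_of_card_fiber_le {α β : Type*} (S : Finset α) (T : Finset β)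
    (f : α → β) (d : ℕ) (hf : ∀ x ∈ S, f x ∈ T)
    (hd : ∀ t ∈ T, (S.filter fun x => f x = t).card ≤ d) (hST : d * T.card ≤ S.card)
    (g : β → ℤ) : ∑ x ∈ S, g (f x) = d * ∑ t ∈ T, g t := by
  have h1 : S.card = ∑ t ∈ T, (S.filter fun x => f x = t).card :=
    Finset.card_eq_sum_card_fiberwise hf
  have h2 : ∑ t ∈ T, (S.filter fun x => f x = t).card = ∑ t ∈ T, d := by
    apply le_antisymm (Finset.sum_le_sum hd)
    rw [← h1, Finset.sum_const, smul_eq_mul, mul_comm]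
    exact hST
  have h3 := (Finset.sum_eq_sum_iff_of_le hd).1 h2
  rw [← Finset.sum_fiberwise_of_maps_to hf, Finset.mul_sum]
  refine Finset.sum_congr rfl fun t ht => ?_
  rw [Finset.sum_congr rfl (g := fun _ => g t) (fun x hx => by rw [(Finset.mem_filter.1 hx).2]),
    Finset.sum_const, h3 t ht, nsmul_eq_mul]

theorem card_filter_pow_eq_le {F : Type*} [Field F] (S : Finset F) (e : ℕ) (he : 0 < e)
    (c : F) : (S.filter fun x => x ^ e = c).card ≤ e := by
  calc (S.filter fun x => x ^ e = c).card
      ≤ (Polynomial.nthRoots e c).toFinset.card := by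
        apply Finset.card_le_card
        intro x hx
        rw [Multiset.mem_toFinset, Polynomial.mem_nthRoots he]
        exact (Finset.mem_filter.1 hx).2
    _ ≤ (Polynomial.nthRoots e c).card := Multiset.toFinset_card_le _
    _ ≤ e := Polynomial.card_nthRoots e c

theorem card_eq_mul_add_one {F : Type*} [Fintype F] {k : ℕ}
    (hF : Fintype.card F = 2 ^ (2 * k)) :
    Fintype.card F = (2 ^ k + 1) * (2 ^ k - 1) + 1 := by
  rw [hF, mul_comm 2 k, pow_mul]
  obtain ⟨c, hc⟩ := Nat.exists_eq_add_of_le (Nat.one_le_two_pow (n := k))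
  rw [hc, Nat.add_sub_cancel_left]
  ring

/-- The group of `d`-th roots of unity of a finite field, as a finset. -/
def unityRoots (F : Type*) [Field F] [Fintype F] (d : ℕ) : Finset F :=
  Finset.univ.filter fun x => x ^ d = 1

section CharTwo

variable {F : Type*} [Field F] [CharP F 2]

theorem absTr_add (k : ℕ) (x y : F) : absTr k (x + y) = absTr k x + absTr k y := by
  simp only [absTr, ← Finset.sum_add_distrib]
  exact Finset.sum_congr rfl fun i _ => add_pow_char_pow x y 2 i

theorem absTr_sq_add_self (k : ℕ) (z : F) : absTr k (z ^ 2 + z) = z ^ 2 ^ k + z := by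
  rw [absTr_add]
  induction k with
  | zero => simp [absTr, CharTwo.add_self_eq_zero]
  | succ k ih =>
    simp only [absTr, Finset.sum_range_succ] at ih ⊢
    have h : (z ^ 2) ^ 2 ^ k = z ^ 2 ^ (k + 1) := by rw [← pow_mul, pow_succ']
    have h2 := CharTwo.add_self_eq_zero (z ^ 2 ^ k)
    linear_combination ih + h + h2

theorem absTr_two_mul (k : ℕ) (x : F) : absTr (2 * k) x = absTr k (x + x ^ 2 ^ k) := by
  rw [absTr_add, two_mul]
  simp only [absTr, Finset.sum_range_add]
  congr 1
  exact Finset.sum_congr rfl fun i _ => by rw [← pow_mul, ← pow_add]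

theorem absTr_eq_zero_or_one (k : ℕ) (x : F) (hx : x ^ 2 ^ k = x) :
    absTr k x = 0 ∨ absTr k x = 1 := by
  have hsq : absTr k x ^ 2 = absTr k (x ^ 2) := by
    simp only [absTr]
    rw [CharTwo.sum_sq]
    exact Finset.sum_congr rfl fun i _ => by rw [← pow_mul, ← pow_mul, mul_comm]
  have h := absTr_sq_add_self k x
  rw [absTr_add, hx, CharTwo.add_self_eq_zero, ← hsq] at h
  have h' : absTr k x * (absTr k x + 1) = 0 := by linear_combination h
  rcases mul_eq_zero.1 h' with h0 | h1
  · exact Or.inl h0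
  · exact Or.inr (CharTwo.add_eq_zero.1 h1)

theorem sgn_add (x y : F) (hx : x = 0 ∨ x = 1) (hy : y = 0 ∨ y = 1) :
    sgn (x + y) = sgn x * sgn y := by
  rcases hx with rfl | rfl <;> rcases hy with rfl | rfl <;>
    simp [sgn, CharTwo.add_self_eq_zero]

theorem tr2_of_pow_three_eq_one (y : F) (hy : y ^ 3 = 1) : tr2 y = if y = 1 then 0 else 1 := by
  split_ifs with h
  · simp [tr2, h, CharTwo.add_self_eq_zero]
  · have h1 : (y - 1) * (y ^ 2 + y + 1) = 0 := by linear_combination hy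
    rcases mul_eq_zero.1 h1 with h2 | h2
    · exact absurd (sub_eq_zero.1 h2) h
    · rw [tr2]
      apply CharTwo.add_eq_zero.1
      linear_combination h2

theorem tr2_eq_zero_or_one (y : F) (hy : y ^ 3 = 1) : tr2 y = 0 ∨ tr2 y = 1 := by
  rw [tr2_of_pow_three_eq_one y hy]
  split_ifs <;> simp

theorem add_inv_ne_zero {u : F} (hu0 : u ≠ 0) (hu1 : u ≠ 1) : u + u⁻¹ ≠ 0 := by
  intro h
  rw [CharTwo.add_eq_zero] at h
  have h2 : u ^ 2 = 1 ^ 2 := by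
    rw [pow_two, one_pow]
    nth_rewrite 2 [h]
    exact mul_inv_cancel₀ hu0
  exact hu1 (CharTwo.sq_injective h2)

end CharTwo

section Finite

variable {F : Type*} [Field F] [Fintype F]

theorem mem_gf {k : ℕ} {x : F} : x ∈ gf F k ↔ x ^ 2 ^ k = x := by simp [gf]

theorem mem_unityRoots {d : ℕ} {x : F} : x ∈ unityRoots F d ↔ x ^ d = 1 := by
  simp [unityRoots]

theorem add_mem_gf [CharP F 2] {k : ℕ} {x y : F} (hx : x ∈ gf F k) (hy : y ∈ gf F k) :
    x + y ∈ gf F k := by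
  rw [mem_gf] at *
  rw [add_pow_char_pow x y 2 k, hx, hy]

theorem mul_mem_gf {k : ℕ} {x y : F} (hx : x ∈ gf F k) (hy : y ∈ gf F k) : x * y ∈ gf F k := by
  rw [mem_gf] at *
  rw [mul_pow, hx, hy]

theorem inv_mem_gf {k : ℕ} {x : F} (hx : x ∈ gf F k) : x⁻¹ ∈ gf F k := by
  rw [mem_gf] at *
  rw [inv_pow, hx]

theorem zero_mem_gf {k : ℕ} : (0 : F) ∈ gf F k := by simp [mem_gf]

theorem gf_erase_zero {k : ℕ} (hk : 0 < k) : (gf F k).erase 0 = unityRoots F (2 ^ k - 1) := by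
  have h1 := Nat.one_lt_two_pow hk.ne'
  have hsub : 2 ^ k = (2 ^ k - 1) + 1 := by omega
  ext x
  rw [Finset.mem_erase, mem_gf, mem_unityRoots, hsub, pow_succ, Nat.add_sub_cancel]
  constructor
  · rintro ⟨h0, h⟩
    exact mul_right_cancel₀ h0 (by rw [h, one_mul])
  · intro h
    refine ⟨?_, by rw [h, one_mul]⟩
    rintro rfl
    rw [zero_pow (by omega)] at h
    exact zero_ne_one h

theorem card_unityRoots {d e : ℕ} (hd : 0 < d) (he : 0 < e) (hF : Fintype.card F = d * e + 1) :
    (unityRoots F d).card = d := by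
  apply le_antisymm (card_filter_pow_eq_le _ d hd 1)
  have hS : ((Finset.univ : Finset F).erase 0).card = d * e := by
    rw [Finset.card_erase_of_mem (Finset.mem_univ _), Finset.card_univ, hF, Nat.add_sub_cancel]
  have hmaps : ∀ x ∈ (Finset.univ : Finset F).erase 0, x ^ e ∈ unityRoots F d := by
    intro x hx
    rw [mem_unityRoots, ← pow_mul, mul_comm e d]
    have := FiniteField.pow_card_sub_one_eq_one x (Finset.ne_of_mem_erase hx)
    rwa [hF, Nat.add_sub_cancel] at this
  have h := Finset.card_le_mul_card_image_of_maps_to (s := (Finset.univ : Finset F).erase 0)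
    (t := unityRoots F d) (f := fun x => x ^ e) hmaps e
    (fun c _ => card_filter_pow_eq_le _ e he c)
  rw [hS, mul_comm d e] at h
  exact Nat.le_of_mul_le_mul_left h he

theorem card_unityRoots_add_one {k : ℕ} (hk : 0 < k) (hF : Fintype.card F = 2 ^ (2 * k)) :
    (unityRoots F (2 ^ k + 1)).card = 2 ^ k + 1 := by
  have h1 := Nat.one_lt_two_pow hk.ne'
  exact card_unityRoots (by omega) (Nat.sub_pos_of_lt h1) (card_eq_mul_add_one hF)

theorem card_unityRoots_sub_one {k : ℕ} (hk : 0 < k) (hF : Fintype.card F = 2 ^ (2 * k)) :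
    (unityRoots F (2 ^ k - 1)).card = 2 ^ k - 1 := by
  have h1 := Nat.one_lt_two_pow hk.ne'
  exact card_unityRoots (e := 2 ^ k + 1) (Nat.sub_pos_of_lt h1) (by omega)
    (by rw [card_eq_mul_add_one hF, mul_comm])

theorem card_gf {k : ℕ} (hk : 0 < k) (hF : Fintype.card F = 2 ^ (2 * k)) :
    (gf F k).card = 2 ^ k := by
  have h := Finset.card_erase_add_one (zero_mem_gf (F := F) (k := k))
  rw [gf_erase_zero hk, card_unityRoots_sub_one hk hF] at h
  have := Nat.one_le_two_pow (n := k)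
  omega

theorem pow_eq_inv_of_mem_unityRoots {k : ℕ} {u : F}
    (hu : u ∈ unityRoots F (2 ^ k + 1)) :
    u ≠ 0 ∧ u ^ 2 ^ k = u⁻¹ := by
  rw [mem_unityRoots, pow_succ] at hu
  exact ⟨right_ne_zero_of_mul_eq_one hu, eq_inv_of_mul_eq_one_left hu⟩

section Kloosterman

variable [CharP F 2] {k : ℕ}

theorem add_inv_mem_gf {u : F} (hu : u ∈ unityRoots F (2 ^ k + 1)) : u + u⁻¹ ∈ gf F k := by
  have h := (pow_eq_inv_of_mem_unityRoots hu).2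
  rw [mem_gf, add_pow_char_pow u _ 2 k, inv_pow, h, inv_inv, add_comm]

theorem absTr_inv_add_inv {u : F} (hu : u ∈ unityRoots F (2 ^ k + 1)) (hu1 : u ≠ 1) :
    absTr k (u + u⁻¹)⁻¹ = 1 := by
  obtain ⟨hu0, h⟩ := pow_eq_inv_of_mem_unityRoots hu
  have h1 : u + 1 ≠ 0 := fun h => hu1 (CharTwo.add_eq_zero.1 h)
  have h1' : 1 + u ≠ 0 := by rwa [add_comm]
  have h2 : u⁻¹ + 1 ≠ 0 := by
    have : u⁻¹ + 1 = (1 + u) / u := by field_simp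
    rw [this]
    exact div_ne_zero h1' hu0
  have h3 := add_inv_ne_zero hu0 hu1
  have hc : (2 : F) = 0 := CharTwo.two_eq_zero
  have hz : (u + u⁻¹)⁻¹ = ((u + 1)⁻¹) ^ 2 + (u + 1)⁻¹ := by
    have h4 : u ^ 2 + 1 = (u + 1) ^ 2 := by linear_combination (-u) * hc
    have h5 : u + u⁻¹ = (u + 1) ^ 2 / u := by
      rw [← h4]
      field_simp
    rw [h5]
    field_simp
    linear_combination -hc
  rw [hz, absTr_sq_add_self, inv_pow, add_pow_char_pow u 1 2 k, h, one_pow]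
  have h6 : u⁻¹ + 1 = (1 + u) / u := by field_simp
  rw [h6]
  field_simp
  ring

theorem sum_sgn_absTr_mul (hk : 0 < k) (hF : Fintype.card F = 2 ^ (2 * k)) {a : F}
    (ha : a ∈ gf F k) (ha0 : a ≠ 0) : ∑ x ∈ gf F k, sgn (absTr k (a * x)) = 0 := by
  have hcard : 1 < (unityRoots F (2 ^ k + 1)).card := by
    rw [card_unityRoots_add_one hk hF]
    have := Nat.one_le_two_pow (n := k)
    omega
  obtain ⟨u, hu, hu1⟩ := Finset.exists_mem_ne hcard 1
  set t := (u + u⁻¹)⁻¹ with ht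
  have htm : t ∈ gf F k := inv_mem_gf (add_inv_mem_gf hu)
  have htr : absTr k t = 1 := absTr_inv_add_inv hu hu1
  have hs : a⁻¹ * t ∈ gf F k := mul_mem_gf (inv_mem_gf ha) htm
  have key : ∑ x ∈ gf F k, sgn (absTr k (a * x)) = ∑ x ∈ gf F k, -sgn (absTr k (a * x)) := by
    refine Finset.sum_bij' (fun x _ => x + a⁻¹ * t) (fun x _ => x + a⁻¹ * t)
      (fun x hx => add_mem_gf hx hs) (fun x hx => add_mem_gf hx hs)
      (fun x _ => by rw [add_assoc, CharTwo.add_self_eq_zero, add_zero])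
      (fun x _ => by rw [add_assoc, CharTwo.add_self_eq_zero, add_zero]) ?_
    intro x hx
    rw [mul_add, mul_inv_cancel_left₀ ha0, absTr_add, htr,
      sgn_add _ _ (absTr_eq_zero_or_one k _ (mem_gf.1 (mul_mem_gf ha hx))) (Or.inr rfl)]
    simp [sgn]
  rw [Finset.sum_neg_distrib] at key
  omega

/-- Summing over `t = u + u⁻¹` counts each nonzero `t` with `Tr(t⁻¹) = 1` twice. -/
theorem sum_unityRoots_erase_one (hk : 0 < k) (hF : Fintype.card F = 2 ^ (2 * k)) (g : F → ℤ) :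
    ∑ u ∈ (unityRoots F (2 ^ k + 1)).erase 1, g (u + u⁻¹) =
      2 * ∑ t ∈ (gf F k).filter (fun t => absTr k t⁻¹ = 1), g t := by
  have h := sum_comp_eq_mul_sum_of_card_fiber_le ((unityRoots F (2 ^ k + 1)).erase 1)
    ((gf F k).filter fun t => absTr k t⁻¹ = 1) (fun u => u + u⁻¹) 2 ?_ ?_ ?_ g
  · exact_mod_cast h
  · intro u hu
    obtain ⟨hu1, hu⟩ := Finset.mem_erase.1 hu
    exact Finset.mem_filter.2 ⟨add_inv_mem_gf hu, absTr_inv_add_inv hu hu1⟩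
  · intro t _
    by_cases hne : ((((unityRoots F (2 ^ k + 1)).erase 1).filter
        fun u => u + u⁻¹ = t)).Nonempty
    · obtain ⟨u, hu⟩ := hne
      obtain ⟨hu, hut⟩ := Finset.mem_filter.1 hu
      have hu0 := (pow_eq_inv_of_mem_unityRoots (Finset.mem_of_mem_erase hu)).1
      refine le_trans (Finset.card_le_card (t := {u, u⁻¹}) ?_) Finset.card_le_two
      intro v hv
      obtain ⟨hv, hvt⟩ := Finset.mem_filter.1 hv
      have hv0 := (pow_eq_inv_of_mem_unityRoots (Finset.mem_of_mem_erase hv)).1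
      have h1 : (v - u) * (v - u⁻¹) = 0 := by
        have e1 := mul_inv_cancel₀ hu0
        have e2 := mul_inv_cancel₀ hv0
        have e3 : v + v⁻¹ = u + u⁻¹ := hvt.trans hut.symm
        linear_combination v * e3 + e1 - e2
      rcases mul_eq_zero.1 h1 with h2 | h2
      · simp [sub_eq_zero.1 h2]
      · simp [sub_eq_zero.1 h2]
    · rw [Finset.not_nonempty_iff_eq_empty.1 hne]
      simp
  · have h0 := sum_sgn_absTr_mul hk hF (a := 1) (by simp [mem_gf]) one_ne_zero
    have h1 : ∑ x ∈ gf F k, sgn (absTr k (1 * x)) = ∑ x ∈ gf F k, sgn (absTr k x⁻¹) :=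
      Finset.sum_bij' (fun x _ => x⁻¹) (fun x _ => x⁻¹) (fun x hx => inv_mem_gf hx)
        (fun x hx => inv_mem_gf hx) (by simp) (by simp) (by simp)
    have h2 : ∀ x ∈ gf F k, sgn (absTr k x⁻¹) = 1 - 2 * if absTr k x⁻¹ = 1 then (1 : ℤ) else 0 := by
      intro x hx
      rcases absTr_eq_zero_or_one k _ (mem_gf.1 (inv_mem_gf hx)) with h | h <;> simp [h, sgn]
    rw [h1, Finset.sum_congr rfl h2, Finset.sum_sub_distrib, ← Finset.mul_sum, Finset.sum_boole,
      Finset.sum_const, card_gf hk hF, nsmul_eq_mul, mul_one] at h0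
    rw [Finset.card_erase_of_mem (by simp [mem_unityRoots]), card_unityRoots_add_one hk hF,
      Nat.add_sub_cancel]
    apply le_of_eq
    zify
    push_cast at h0
    linarith

theorem sum_unityRoots_sgn_absTr (hk : 0 < k) (hF : Fintype.card F = 2 ^ (2 * k)) {a : F}
    (ha : a ∈ gf F k) (ha0 : a ≠ 0) :
    ∑ u ∈ unityRoots F (2 ^ k + 1), sgn (absTr (2 * k) (a * u)) = 1 - kloo k a := by
  have h1 : ∀ u ∈ unityRoots F (2 ^ k + 1),
      sgn (absTr (2 * k) (a * u)) = sgn (absTr k (a * (u + u⁻¹))) := by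
    intro u hu
    rw [absTr_two_mul, mul_pow, mem_gf.1 ha, (pow_eq_inv_of_mem_unityRoots hu).2, mul_add]
  have hone : (1 : F) ∈ unityRoots F (2 ^ k + 1) := by simp [mem_unityRoots]
  rw [Finset.sum_congr rfl h1, ← Finset.add_sum_erase _ _ hone,
    sum_unityRoots_erase_one hk hF fun t => sgn (absTr k (a * t))]
  have h2 : ∀ x ∈ gf F k, sgn (absTr k (a * x + x⁻¹)) = sgn (absTr k (a * x)) -
      2 * if absTr k x⁻¹ = 1 then sgn (absTr k (a * x)) else 0 := by
    intro x hx
    rw [absTr_add, sgn_add _ _ (absTr_eq_zero_or_one k _ (mem_gf.1 (mul_mem_gf ha hx)))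
      (absTr_eq_zero_or_one k _ (mem_gf.1 (inv_mem_gf hx)))]
    rcases absTr_eq_zero_or_one k _ (mem_gf.1 (inv_mem_gf hx)) with h | h
    · simp [h, sgn]
    · rw [h, if_pos rfl]
      simp only [sgn, one_ne_zero, if_false]
      ring
  have h3 : sgn (absTr k (a * ((1 : F) + 1⁻¹))) = 1 := by
    simp [CharTwo.add_self_eq_zero, absTr, sgn]
  rw [kloo, Finset.sum_congr rfl h2, Finset.sum_sub_distrib, sum_sgn_absTr_mul hk hF ha ha0,
    ← Finset.mul_sum, ← Finset.sum_filter, h3]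
  ring

end Kloosterman

section Walsh

variable [CharP F 2] {k : ℕ}

theorem sum_comp_pow_sub_one_pow_add_one (hk : 0 < k) (hF : Fintype.card F = 2 ^ (2 * k))
    (g : F × F → ℤ) :
    ∑ x ∈ (Finset.univ : Finset F).erase 0, g (x ^ (2 ^ k - 1), x ^ (2 ^ k + 1)) =
      ∑ p ∈ unityRoots F (2 ^ k + 1) ×ˢ unityRoots F (2 ^ k - 1), g p := by
  have h1 := Nat.one_le_two_pow (n := k)
  have h := sum_comp_eq_mul_sum_of_card_fiber_le ((Finset.univ : Finset F).erase 0)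
    (unityRoots F (2 ^ k + 1) ×ˢ unityRoots F (2 ^ k - 1))
    (fun x => (x ^ (2 ^ k - 1), x ^ (2 ^ k + 1))) 1 ?_ ?_ ?_ g
  · simpa using h
  · intro x hx
    have := FiniteField.pow_card_sub_one_eq_one x (Finset.ne_of_mem_erase hx)
    rw [card_eq_mul_add_one hF, Nat.add_sub_cancel] at this
    rw [Finset.mem_product, mem_unityRoots, mem_unityRoots, ← pow_mul, ← pow_mul, this,
      mul_comm, this]
    exact ⟨rfl, rfl⟩
  · intro t _
    rw [Finset.card_le_one]
    intro x hx y hy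
    simp only [Finset.mem_filter] at hx hy
    obtain ⟨hx, hxt⟩ := hx
    obtain ⟨hy, hyt⟩ := hy
    obtain ⟨e1, e2⟩ := Prod.mk.inj (hxt.trans hyt.symm)
    have hk2 : 2 ^ k + 1 = (2 ^ k - 1) + 2 := by omega
    rw [hk2, pow_add, pow_add, e1] at e2
    exact CharTwo.sq_injective
      (mul_left_cancel₀ (pow_ne_zero _ (Finset.ne_of_mem_erase hy)) e2)
  · rw [Finset.card_erase_of_mem (Finset.mem_univ _), Finset.card_univ, card_eq_mul_add_one hF,
      Finset.card_product, card_unityRoots_add_one hk hF, card_unityRoots_sub_one hk hF]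
    omega

theorem sum_sgn_tr2 (hk : 0 < k) (hF : Fintype.card F = 2 ^ (2 * k)) {e : ℕ} (he : 0 < e)
    (hke : 2 ^ k - 1 = 3 * e) {b : F} (hb : b ^ 3 = 1) :
    ∑ w ∈ unityRoots F (2 ^ k - 1), sgn (tr2 (b * w ^ e)) = -e := by
  have hb0 : b ≠ 0 := by
    rintro rfl
    simp at hb
  have h3 : (unityRoots F 3).card = 3 := by
    refine card_unityRoots (e := (2 ^ k + 1) * e) (by norm_num) (by positivity) ?_
    rw [card_eq_mul_add_one hF, hke]
    ring
  have h := sum_comp_eq_mul_sum_of_card_fiber_le (unityRoots F (2 ^ k - 1)) (unityRoots F 3)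
    (fun w => b * w ^ e) e ?_ ?_ ?_ (fun y => sgn (tr2 y))
  · have h1 : ∀ y ∈ unityRoots F 3, sgn (tr2 y) = 2 * (if y = 1 then 1 else 0) - 1 := by
      intro y hy
      rw [tr2_of_pow_three_eq_one y (mem_unityRoots.1 hy)]
      split_ifs <;> simp [sgn]
    have hone : (1 : F) ∈ unityRoots F 3 := by simp [mem_unityRoots]
    rw [Finset.sum_congr rfl h1, Finset.sum_sub_distrib, ← Finset.mul_sum, Finset.sum_ite_eq',
      if_pos hone, Finset.sum_const, h3] at h
    rw [h]
    norm_num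
  · intro w hw
    rw [mem_unityRoots] at *
    rw [mul_pow, hb, ← pow_mul, mul_comm e 3, ← hke, hw, one_mul]
  · intro t _
    refine le_trans (Finset.card_le_card ?_)
      (card_filter_pow_eq_le (unityRoots F (2 ^ k - 1)) e he (b⁻¹ * t))
    intro w hw
    rw [Finset.mem_filter] at *
    exact ⟨hw.1, by rw [← hw.2, inv_mul_cancel_left₀ hb0]⟩
  · rw [h3, card_unityRoots_sub_one hk hF, hke, mul_comm]

theorem walsh_fAB_zero (hk : 0 < k) (hF : Fintype.card F = 2 ^ (2 * k)) {e : ℕ} (he : 0 < e)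
    (hke : 2 ^ k - 1 = 3 * e) {a b : F} (ha : a ∈ gf F k) (ha0 : a ≠ 0) (hb : b ^ 3 = 1) :
    walsh (2 * k) (fAB (2 * k) k a b) 0 = 1 - e * (1 - kloo k a) := by
  have hn : (2 ^ (2 * k) - 1) / 3 = (2 ^ k + 1) * e := by
    rw [← hF, card_eq_mul_add_one hF, hke, Nat.add_sub_cancel]
    rw [show (2 ^ k + 1) * (3 * e) = 3 * ((2 ^ k + 1) * e) by ring]
    exact Nat.mul_div_cancel_left _ (by norm_num)
  have h0 : ∀ j, absTr j (0 : F) = 0 := fun j => by simp [absTr]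
  have hx0 : fAB (2 * k) k a b 0 = 0 := by
    rw [fAB, fA, gB, chi, hn, zero_pow (by omega), zero_pow (by positivity), mul_zero, mul_zero,
      h0]
    simp [tr2]
  have hx : ∀ x ∈ (Finset.univ : Finset F).erase 0, sgn (fAB (2 * k) k a b x) =
      (fun p : F × F => sgn (absTr (2 * k) (a * p.1)) * sgn (tr2 (b * p.2 ^ e)))
        (x ^ (2 ^ k - 1), x ^ (2 ^ k + 1)) := by
    intro x hx
    have hx1 := FiniteField.pow_card_sub_one_eq_one x (Finset.ne_of_mem_erase hx)
    rw [card_eq_mul_add_one hF, Nat.add_sub_cancel, hke] at hx1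
    rw [fAB, fA, gB, chi, hn, pow_mul]
    apply sgn_add
    · apply absTr_eq_zero_or_one
      rw [← hF, FiniteField.pow_card]
    · apply tr2_eq_zero_or_one
      rw [mul_pow, hb, ← pow_mul, ← pow_mul, one_mul, ← hx1]
      congr 1
      ring
  simp only [walsh, zero_mul, h0, add_zero]
  rw [← Finset.add_sum_erase _ _ (Finset.mem_univ (0 : F)), hx0, Finset.sum_congr rfl hx,
    sum_comp_pow_sub_one_pow_add_one hk hF
      (fun p : F × F => sgn (absTr (2 * k) (a * p.1)) * sgn (tr2 (b * p.2 ^ e))),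
    Finset.sum_product]
  simp only [← Finset.mul_sum]
  rw [sum_sgn_tr2 hk hF he hke hb, ← Finset.sum_mul, sum_unityRoots_sgn_absTr hk hF ha ha0]
  simp only [sgn, if_true]
  ring

end Walsh

theorem two_sub_card_gf_le_kloo (k : ℕ) (a : F) : 2 - ((gf F k).card : ℤ) ≤ kloo k a := by
  rw [kloo, ← Finset.add_sum_erase _ _ (zero_mem_gf (F := F) (k := k))]
  have h1 : ∑ x ∈ (gf F k).erase 0, (-1 : ℤ) ≤
      ∑ x ∈ (gf F k).erase 0, sgn (absTr k (a * x + x⁻¹)) :=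
    Finset.sum_le_sum fun x _ => by
      rw [sgn]
      split_ifs <;> norm_num
  have h2 := Finset.card_erase_add_one (zero_mem_gf (F := F) (k := k))
  have h3 : sgn (absTr k (a * 0 + (0 : F)⁻¹)) = 1 := by simp [absTr, sgn]
  rw [Finset.sum_const, nsmul_eq_mul] at h1
  rw [h3]
  push_cast [← h2]
  linarith

end Finite

/-- For `ν > 1`, `a ∈ F_{2^{m₁}}^*` and `b ∈ F_4^*`: if `f_{a,b}` is bent
(i.e. its Walsh transform only takes the values `±2^{n/2} = ±2^{m₁}`),
then `K_{m₁}(a) = 4`. -/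
theorem bent_implies_kloosterman_four_even_case
    {F : Type*} [Field F] [Fintype F]
    (n ν m : ℕ) (hν : 1 < ν) (hm : Odd m) (hn : n = 2 ^ ν * m)
    (hF : Fintype.card F = 2 ^ n)
    (a b : F) (ha : a ^ 2 ^ (2 ^ (ν - 1) * m) = a) (ha0 : a ≠ 0)
    (hb : b ^ 3 = 1) (hb0 : b ≠ 0)
    (hbent : ∀ ω : F, walsh n (fAB n (2 ^ (ν - 1) * m) a b) ω = 2 ^ (2 ^ (ν - 1) * m)
      ∨ walsh n (fAB n (2 ^ (ν - 1) * m) a b) ω = -2 ^ (2 ^ (ν - 1) * m)) :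
    kloo (2 ^ (ν - 1) * m) a = 4 := by
  have hk2 : n = 2 * (2 ^ (ν - 1) * m) := by
    rw [hn, ← mul_assoc, ← pow_succ', Nat.sub_add_cancel hν.le]
  have heven : Even (2 ^ (ν - 1) * m) :=
    ((Nat.even_pow.2 ⟨even_two, by omega⟩).mul_right m)
  have hk : 0 < 2 ^ (ν - 1) * m := Nat.mul_pos (by positivity) hm.pos
  generalize 2 ^ (ν - 1) * m = k at *
  subst hk2
  have hchar : CharP F 2 := charP_of_card_eq_prime_pow hF
  obtain ⟨e, hke⟩ : 3 ∣ 2 ^ k - 1 := by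
    obtain ⟨j, rfl⟩ := heven
    rw [← two_mul, pow_mul]
    have h := Nat.sub_dvd_pow_sub_pow (2 ^ 2) 1 j
    rwa [one_pow] at h
  have hk1 := Nat.one_lt_two_pow hk.ne'
  have he : 0 < e := by omega
  have hw := walsh_fAB_zero hk hF he hke (mem_gf.2 ha) ha0 hb
  have hle := two_sub_card_gf_le_kloo k a
  rw [card_gf hk hF] at hle
  have hq : (2 : ℤ) ^ k = 3 * e + 1 := by
    have : 2 ^ k = 3 * e + 1 := by omega
    exact_mod_cast this
  push_cast at hle
  have he' : (0 : ℤ) < e := by exact_mod_cast he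
  rcases hbent 0 with h | h
  · rw [h, hq] at hw
    have : (e : ℤ) * (kloo k a - 4) = 0 := by linarith
    rcases mul_eq_zero.1 this with h0 | h0
    · omega
    · omega
  · rw [h, hq] at hw
    have h2 : (e : ℤ) * (-kloo k a - 2) = 2 := by linarith
    have hdvd : e ∣ 2 := by exact_mod_cast Dvd.intro _ h2
    have he2 : e ≤ 2 := Nat.le_of_dvd two_pos hdvd
    interval_cases e
    · norm_num at hq hw hle
      omega
    · exfalso
      have h7 : Even (2 ^ k) := Nat.even_pow.2 ⟨even_two, hk.ne'⟩
      have : 2 ^ k = 7 := by omega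
      rw [this] at h7
      revert h7
      decide
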